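/- For every x ∈ [0, 1] and every δ > 0, the intersection X_iso ∩ (x−δ, x+δ) contains a nonempty open interval. -/

import Mathlib

open scoped ENNReal NNReal Classical

namespace Expansions

/-- Digit sequences over the alphabet `{0,1,…,M}`; index `i : ℕ` represents the
`(i+1)`-st digit `d_{i+1}` of the paper. -/
abbrev Digits (M : ℕ) := ℕ → Fin (M + 1)

/-- `π_q((d_i)) = Σ_{i≥1} d_i / q^i`. -/
noncomputable def piQ (M : ℕ) (q : ℝ) (d : Digits M) : ℝ :=
  ∑' i : ℕ, (d i : ℝ) / q ^ (i + 1)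

/-- `𝒰_q` : the set of real numbers having a unique `q`-expansion. -/
def Uq (M : ℕ) (q : ℝ) : Set ℝ := {x | ∃! d : Digits M, piQ M q d = x}

/-- `𝐔_q` : the set of sequences that are the unique `q`-expansion of their value. -/
def UqSym (M : ℕ) (q : ℝ) : Set (Digits M) :=
  {d | ∀ e : Digits M, piQ M q e = piQ M q d → e = d}

/-- `𝒰(x)` : the set of univoque bases of `x`. -/
def Ubases (M : ℕ) (x : ℝ) : Set ℝ :=
  {q | q ∈ Set.Ioc (1 : ℝ) ((M : ℝ) + 1) ∧ x ∈ Uq M q}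

/-- `q_x = min{M+1, 1+M/x}`. -/
noncomputable def qx (M : ℕ) (x : ℝ) : ℝ := min ((M : ℝ) + 1) (1 + (M : ℝ) / x)

/-- Strict lexicographic order on digit sequences. -/
def lexLt {M : ℕ} (c d : Digits M) : Prop := ∃ n, (∀ i < n, c i = d i) ∧ c n < d n

def lexLe {M : ℕ} (c d : Digits M) : Prop := c = d ∨ lexLt c d

/-- The sequence ends with `0^∞`. -/
def EndsInZero {M : ℕ} (d : Digits M) : Prop := ∃ N, ∀ n ≥ N, d n = 0

/-- `d` is the quasi-greedy `q`-expansion of `x`: the lexicographically largest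
`q`-expansion of `x` not ending with `0^∞`. -/
def IsQuasiGreedy (M : ℕ) (q x : ℝ) (d : Digits M) : Prop :=
  piQ M q d = x ∧ ¬ EndsInZero d ∧
    ∀ e : Digits M, piQ M q e = x → ¬ EndsInZero e → lexLe e d

/-- `Φ_x(q)`: the quasi-greedy `q`-expansion of `x` (junk value if none exists). -/
noncomputable def Phi (M : ℕ) (x q : ℝ) : Digits M :=
  if h : ∃ d : Digits M, IsQuasiGreedy M q x d then h.choose else fun _ => 0

/-- `𝐔(x) = {Φ_x(q) : q ∈ 𝒰(x)}`. -/
def UxSym (M : ℕ) (x : ℝ) : Set (Digits M) := (Phi M x) '' (Ubases M x)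

/-- `ρ((c_i),(d_i)) = (M+1)^{-inf{i ≥ 1 : c_i ≠ d_i}}` (our index `n` represents the
`(n+1)`-st digit, whence the exponent `-(n+1)`); `ρ(c,c) = 0`. -/
noncomputable def rho (M : ℕ) (c d : Digits M) : ℝ :=
  if c = d then 0
  else ((M : ℝ) + 1) ^ (-(((sInf {i | c i ≠ d i} : ℕ) : ℤ) + 1))

/-- Diameter of a set with respect to a distance function, valued in `ℝ≥0∞`. -/
noncomputable def gdiam {X : Type*} (dist : X → X → ℝ) (A : Set X) : ℝ≥0∞ :=
  ⨆ x ∈ A, ⨆ y ∈ A, ENNReal.ofReal (dist x y)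

/-- The `s`-dimensional Hausdorff outer measure with respect to a distance function:
`lim_{δ→0⁺} inf {Σ diam(C n)^s : A ⊆ ⋃ C n, diam (C n) ≤ δ}`. -/
noncomputable def gHMeasure {X : Type*} (dist : X → X → ℝ) (s : ℝ) (A : Set X) : ℝ≥0∞ :=
  ⨆ (δ : ℝ) (_ : 0 < δ),
    ⨅ (C : ℕ → Set X) (_ : A ⊆ ⋃ n, C n)
      (_ : ∀ n, gdiam dist (C n) ≤ ENNReal.ofReal δ),
      ∑' n, gdiam dist (C n) ^ s

/-- Hausdorff dimension with respect to a distance function. -/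
noncomputable def gdimH {X : Type*} (dist : X → X → ℝ) (A : Set X) : ℝ≥0∞ :=
  ⨆ (s : ℝ≥0) (_ : gHMeasure dist (s : ℝ) A = ⊤), (s : ℝ≥0∞)

/-- The generalized golden ratio `q_G`. -/
noncomputable def qG (M : ℕ) : ℝ :=
  if M % 2 = 0 then ((M / 2 : ℕ) : ℝ) + 1
  else (((M / 2 : ℕ) : ℝ) + 1 +
    Real.sqrt (((M / 2 : ℕ) : ℝ) ^ 2 + 6 * ((M / 2 : ℕ) : ℝ) + 5)) / 2

/-- `x_G = M/(q_G - 1)`. -/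
noncomputable def xG (M : ℕ) : ℝ := (M : ℝ) / (qG M - 1)

/-- The Komornik–Loreti constant `q_KL = min 𝒰(1)`. -/
noncomputable def qKL (M : ℕ) : ℝ := sInf (Ubases M 1)

/-- `x_KL = M/(q_KL - 1)`. -/
noncomputable def xKL (M : ℕ) : ℝ := (M : ℝ) / (qKL M - 1)

/-- `X_iso`: the set of `x > 0` such that `𝒰(x)` contains an isolated point. -/
def Xiso (M : ℕ) : Set ℝ :=
  {x | 0 < x ∧ ∃ q ∈ Ubases M x, ∃ ε > 0, Ubases M x ∩ Set.Ioo (q - ε) (q + ε) = {q}}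

/-- The bifurcation set `𝒱 = {q ∈ (1,M+1] : 𝐔_r ≠ 𝐔_q for all r > q}`. -/
def Vset (M : ℕ) : Set ℝ :=
  {q | q ∈ Set.Ioc (1 : ℝ) ((M : ℝ) + 1) ∧
    ∀ r ∈ Set.Ioc (1 : ℝ) ((M : ℝ) + 1), q < r → UqSym M r ≠ UqSym M q}

/-- The Thue–Morse sequence `τ_i` = parity of the binary digit sum of `i`. -/
def tm (i : ℕ) : ℕ := (Nat.digits 2 i).sum % 2


open Filter Topology

/-- The sequence with its first `n` digits removed. -/
def shift {M : ℕ} (n : ℕ) (d : Digits M) : Digits M := fun i => d (n + i)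

/-- The digitwise reflection `c ↦ M - c`. -/
def conj {M : ℕ} (d : Digits M) : Digits M := fun i => (d i).rev

@[simp] lemma shift_apply {M : ℕ} (n i : ℕ) (d : Digits M) : shift n d i = d (n + i) := rfl

lemma shift_shift {M : ℕ} (a b : ℕ) (d : Digits M) : shift a (shift b d) = shift (b + a) d := by
  funext i
  simp [add_assoc]

lemma shift_zero {M : ℕ} (d : Digits M) : shift 0 d = d := by
  funext i
  simp

lemma shift_conj {M : ℕ} (n : ℕ) (d : Digits M) : shift n (conj d) = conj (shift n d) := rfl

lemma conj_val {M : ℕ} (d : Digits M) (i : ℕ) : ((conj d i : Fin (M + 1)) : ℕ) = M - (d i : ℕ) := by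
  simp [conj, Fin.val_rev]

lemma digit_le {M : ℕ} (d : Digits M) (i : ℕ) : (d i : ℕ) ≤ M := Nat.lt_succ_iff.mp (d i).isLt

lemma conj_cast {M : ℕ} (d : Digits M) (i : ℕ) : ((conj d i : Fin (M + 1)) : ℝ) = M - (d i : ℝ) := by
  rw [conj_val, Nat.cast_sub (digit_le d i)]

lemma digit_cast_le {M : ℕ} (d : Digits M) (i : ℕ) : (d i : ℝ) ≤ M := by
  exact_mod_cast digit_le d i

lemma hasSum_const_digits (M : ℕ) {q : ℝ} (hq : 1 < q) :
    HasSum (fun i : ℕ => (M : ℝ) / q ^ (i + 1)) (M / (q - 1)) := by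
  have h := (hasSum_geometric_of_lt_one (inv_nonneg.2 (by linarith : (0 : ℝ) ≤ q))
    (inv_lt_one_of_one_lt₀ hq)).mul_left (M / q)
  have hq0 : q ≠ 0 := by linarith
  have hq1 : q - 1 ≠ 0 := by linarith
  have hsum : (M : ℝ) / q * (1 - q⁻¹)⁻¹ = M / (q - 1) := by
    rw [show 1 - q⁻¹ = (q - 1) / q by field_simp]
    field_simp
  rw [← hsum]
  refine h.congr_fun fun i => ?_
  rw [inv_pow]
  field_simp
  ring

lemma summable_digits {M : ℕ} {q : ℝ} (hq : 1 < q) (d : Digits M) :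
    Summable (fun i : ℕ => (d i : ℝ) / q ^ (i + 1)) := by
  refine Summable.of_nonneg_of_le (fun i => by positivity) (fun i => ?_)
    (hasSum_const_digits M hq).summable
  have := digit_cast_le d i
  gcongr

lemma piQ_nonneg {M : ℕ} {q : ℝ} (hq : 1 < q) (d : Digits M) : 0 ≤ piQ M q d :=
  tsum_nonneg fun i => by positivity

lemma piQ_conj {M : ℕ} {q : ℝ} (hq : 1 < q) (d : Digits M) :
    piQ M q (conj d) = M / (q - 1) - piQ M q d := by
  rw [piQ, piQ, ← (hasSum_const_digits M hq).tsum_eq,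
    ← (hasSum_const_digits M hq).summable.tsum_sub (summable_digits hq d)]
  congr 1
  funext i
  rw [conj_cast, sub_div]

lemma piQ_le {M : ℕ} {q : ℝ} (hq : 1 < q) (d : Digits M) : piQ M q d ≤ M / (q - 1) := by
  have := piQ_nonneg hq (conj d)
  rw [piQ_conj hq] at this
  linarith

lemma piQ_eq_sum_add {M : ℕ} {q : ℝ} (hq : 1 < q) (d : Digits M) (n : ℕ) :
    piQ M q d = ∑ i ∈ Finset.range n, (d i : ℝ) / q ^ (i + 1) + piQ M q (shift n d) / q ^ n := by
  rw [piQ, ← (summable_digits hq d).sum_add_tsum_nat_add n, piQ, ← tsum_div_const]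
  congr 2
  funext i
  rw [shift_apply, add_comm i n, div_div, ← pow_add]
  congr 2
  ring

lemma piQ_eq_div {M : ℕ} {q : ℝ} (hq : 1 < q) (d : Digits M) :
    piQ M q d = ((d 0 : ℝ) + piQ M q (shift 1 d)) / q := by
  rw [piQ_eq_sum_add hq d 1]
  simp [add_div]

lemma piQ_shift_succ {M : ℕ} {q : ℝ} (hq : 1 < q) (d : Digits M) (n : ℕ) :
    piQ M q (shift (n + 1) d) = q * piQ M q (shift n d) - d n := by
  rw [piQ_eq_div hq (shift n d), shift_shift, shift_apply, add_zero]
  field_simp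
  ring

lemma piQ_shift_div_le {M : ℕ} {q : ℝ} (hq : 1 < q) (d : Digits M) (n : ℕ) :
    piQ M q (shift n d) / q ^ n ≤ piQ M q d := by
  rw [piQ_eq_sum_add hq d n]
  have : 0 ≤ ∑ i ∈ Finset.range n, (d i : ℝ) / q ^ (i + 1) :=
    Finset.sum_nonneg fun i _ => by positivity
  linarith

lemma inv_pow_le_piQ {M : ℕ} {q : ℝ} (hq : 1 < q) (d : Digits M) {n : ℕ} (hn : 0 < (d n : ℕ)) :
    (q ^ (n + 1))⁻¹ ≤ piQ M q d := by
  refine le_trans ?_ ((summable_digits hq d).le_tsum n fun i _ => by positivity)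
  have : (1 : ℝ) ≤ (d n : ℝ) := by exact_mod_cast hn
  rw [inv_eq_one_div]
  gcongr

lemma piQ_le_of_lt {M : ℕ} {q : ℝ} (hq : 1 < q) (d : Digits M) {n : ℕ} (hn : (d n : ℕ) < M) :
    piQ M q d ≤ M / (q - 1) - (q ^ (n + 1))⁻¹ := by
  have := inv_pow_le_piQ hq (conj d) (n := n) (by rw [conj_val]; omega)
  rw [piQ_conj hq] at this
  linarith

lemma abs_piQ_sub_le {M : ℕ} {q : ℝ} (hq : 1 < q) {d e : Digits M} {n : ℕ}
    (h : ∀ i < n, d i = e i) : |piQ M q d - piQ M q e| ≤ M / (q - 1) / q ^ n := by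
  rw [piQ_eq_sum_add hq d n, piQ_eq_sum_add hq e n,
    Finset.sum_congr rfl fun i hi => by rw [h i (Finset.mem_range.1 hi)],
    add_sub_add_left_eq_sub, ← sub_div, abs_div, abs_of_pos (by positivity : 0 < q ^ n)]
  have h1 := piQ_nonneg hq (shift n d)
  have h2 := piQ_le hq (shift n d)
  have h3 := piQ_nonneg hq (shift n e)
  have h4 := piQ_le hq (shift n e)
  gcongr
  rw [abs_le]
  constructor <;> linarith

lemma piQ_of_max_prefix {M : ℕ} {q : ℝ} (hq : 1 < q) {d : Digits M} {n : ℕ}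
    (h : ∀ i < n, (d i : ℕ) = M) :
    piQ M q d = M / (q - 1) * (1 - (q ^ n)⁻¹) + (q ^ n)⁻¹ * piQ M q (shift n d) := by
  have h0 := piQ_eq_sum_add hq (conj d) n
  rw [Finset.sum_eq_zero fun i hi => by
    rw [conj_val, h i (Finset.mem_range.1 hi)]; simp, shift_conj, piQ_conj hq, piQ_conj hq] at h0
  rw [zero_add, div_eq_inv_mul _ (q ^ n)] at h0
  linarith

/-- Strict orbit inequalities characterizing unique expansions. -/
def IsUnivoque (M : ℕ) (q : ℝ) (d : Digits M) : Prop :=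
  ∀ j, ((d j : ℕ) < M → piQ M q (shift (j + 1) d) < 1) ∧
    (0 < (d j : ℕ) → (M : ℝ) / (q - 1) - 1 < piQ M q (shift (j + 1) d))

lemma IsUnivoque.shift {M : ℕ} {q : ℝ} {d : Digits M} (h : IsUnivoque M q d) (n : ℕ) :
    IsUnivoque M q (shift n d) := fun j => by
  rw [shift_shift]
  exact h (n + j)

lemma IsUnivoque.conj {M : ℕ} {q : ℝ} (hq : 1 < q) {d : Digits M} (h : IsUnivoque M q d) :
    IsUnivoque M q (conj d) := fun j => by
  rw [shift_conj, piQ_conj hq, conj_val]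
  have := digit_le d j
  refine ⟨fun hj => ?_, fun hj => ?_⟩
  · linarith [(h j).2 (by omega)]
  · linarith [(h j).1 (by omega)]

lemma exists_orbit {q y : ℝ} {M : ℕ} (g : ℝ → Fin (M + 1)) :
    ∃ (d : Digits M) (z : ℕ → ℝ), z 0 = y ∧ ∀ n, d n = g (z n) ∧ z (n + 1) = q * z n - d n :=
  ⟨fun n => g (Nat.rec y (fun _ z => q * z - (g z : ℝ)) n),
    fun n => Nat.rec y (fun _ z => q * z - (g z : ℝ)) n, rfl, fun _ => ⟨rfl, rfl⟩⟩

lemma exists_expansion {M : ℕ} {q : ℝ} (hq : 1 < q) (hqM : q ≤ M + 1) {y : ℝ} (hy0 : 0 ≤ y)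
    (hy : y ≤ M / (q - 1)) : ∃ d : Digits M, piQ M q d = y := by
  have hA : 1 ≤ (M : ℝ) / (q - 1) := by
    rw [le_div_iff₀ (by linarith)]
    linarith
  have hAq : q * (M / (q - 1)) - M = (M : ℝ) / (q - 1) := by
    have : q - 1 ≠ 0 := by linarith
    field_simp
    ring
  have step : ∀ z : ℝ, ∃ c : Fin (M + 1), 0 ≤ z → z ≤ M / (q - 1) →
      0 ≤ q * z - (c : ℝ) ∧ q * z - (c : ℝ) ≤ M / (q - 1) := by
    intro z
    by_cases hz : q * z < M + 1
    · refine ⟨⟨min M ⌊q * z⌋₊, by omega⟩, fun h0 _ => ?_⟩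
      have hqz : 0 ≤ q * z := by positivity
      have : ⌊q * z⌋₊ ≤ M := by
        rw [← Nat.lt_succ_iff, Nat.floor_lt hqz]
        exact_mod_cast hz
      simp only [min_eq_right this]
      have h1 := Nat.floor_le hqz
      have h2 := Nat.lt_floor_add_one (q * z)
      constructor <;> linarith
    · refine ⟨Fin.last M, fun _ h1 => ?_⟩
      have := mul_le_mul_of_nonneg_left h1 (by linarith : 0 ≤ q)
      simp only [Fin.val_last]
      constructor <;> linarith
  choose g hg using step
  obtain ⟨d, z, hz0, hz⟩ := exists_orbit (q := q) (y := y) g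
  have hzm : ∀ n, 0 ≤ z n ∧ z n ≤ M / (q - 1) := by
    intro n
    induction n with
    | zero => rw [hz0]; exact ⟨hy0, hy⟩
    | succ n ih => rw [(hz n).2, (hz n).1]; exact hg _ ih.1 ih.2
  refine ⟨d, ?_⟩
  have hdiff : ∀ n, z n - piQ M q (shift n d) = (y - piQ M q d) * q ^ n := by
    intro n
    induction n with
    | zero => rw [hz0, shift_zero]; simp
    | succ n ih =>
      rw [(hz n).2, piQ_shift_succ hq, pow_succ, ← mul_assoc, ← ih]
      ring
  by_contra hne
  have hpos : 0 < |y - piQ M q d| := abs_pos.2 (sub_ne_zero.2 (Ne.symm hne))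
  obtain ⟨n, hn⟩ := pow_unbounded_of_one_lt (M / (q - 1) / |y - piQ M q d|) hq
  rw [div_lt_iff₀ hpos] at hn
  have h1 : |y - piQ M q d| * q ^ n ≤ M / (q - 1) := by
    rw [← abs_of_pos (by positivity : 0 < q ^ n), ← abs_mul, ← hdiff, abs_le]
    have := piQ_nonneg hq (shift n d)
    have := piQ_le hq (shift n d)
    constructor <;> linarith [(hzm n).1, (hzm n).2]
  linarith

lemma IsUnivoque.eq_of_piQ_eq {M : ℕ} {q : ℝ} (hq : 1 < q) {d e : Digits M}
    (hd : IsUnivoque M q d) (h : piQ M q e = piQ M q d) : e = d := by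
  have key : ∀ n, e n = d n ∧ piQ M q (Expansions.shift n e) = piQ M q (Expansions.shift n d) := by
    have digit : ∀ n, piQ M q (Expansions.shift n e) = piQ M q (Expansions.shift n d) →
        e n = d n := by
      intro n hn
      have h1 := piQ_shift_succ hq d n
      have h2 := piQ_shift_succ hq e n
      rw [hn] at h2
      rcases lt_trichotomy (e n) (d n) with hlt | heq | hgt
      · have hlt' : (e n : ℕ) < d n := hlt
        have h3 := (hd n).2 (by omega)
        have h4 := piQ_le hq (Expansions.shift (n + 1) e)
        have h5 : (e n : ℝ) + 1 ≤ d n := by exact_mod_cast hlt'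
        linarith
      · exact heq
      · have hlt' : (d n : ℕ) < e n := hgt
        have h3 := (hd n).1 (by have := digit_le e n; omega)
        have h4 := piQ_nonneg hq (Expansions.shift (n + 1) e)
        have h5 : (d n : ℝ) + 1 ≤ e n := by exact_mod_cast hlt'
        linarith
    intro n
    induction n with
    | zero =>
      have : piQ M q (Expansions.shift 0 e) = piQ M q (Expansions.shift 0 d) := by
        rw [shift_zero, shift_zero, h]
      exact ⟨digit 0 this, this⟩
    | succ n ih =>
      have : piQ M q (Expansions.shift (n + 1) e) = piQ M q (Expansions.shift (n + 1) d) := by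
        rw [piQ_shift_succ hq, piQ_shift_succ hq, ih.1, ih.2]
      exact ⟨digit _ this, this⟩
  exact funext fun n => (key n).1

lemma IsUnivoque.mem_Uq {M : ℕ} {q : ℝ} (hq : 1 < q) {d : Digits M} (hd : IsUnivoque M q d) :
    piQ M q d ∈ Uq M q := ⟨d, rfl, fun _ he => hd.eq_of_piQ_eq hq he⟩

/-- Keep the first `n` digits of `d`, put `c` next, and continue with `f`. -/
def splice {M : ℕ} (n : ℕ) (d : Digits M) (c : Fin (M + 1)) (f : Digits M) : Digits M :=
  fun i => if i < n then d i else if i = n then c else f (i - (n + 1))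

lemma shift_splice {M : ℕ} (n : ℕ) (d : Digits M) (c : Fin (M + 1)) (f : Digits M) :
    shift (n + 1) (splice n d c f) = f := by
  funext i
  have h1 : ¬ n + 1 + i < n := by omega
  have h2 : n + 1 + i ≠ n := by omega
  simp [splice, h1, h2]

lemma piQ_splice {M : ℕ} {q : ℝ} (hq : 1 < q) (n : ℕ) (d : Digits M) (c : Fin (M + 1))
    (f : Digits M) (h : (c : ℝ) + piQ M q f = (d n : ℝ) + piQ M q (shift (n + 1) d)) :
    piQ M q (splice n d c f) = piQ M q d := by
  rw [piQ_eq_sum_add hq d (n + 1), piQ_eq_sum_add hq (splice n d c f) (n + 1), shift_splice,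
    Finset.sum_range_succ, Finset.sum_range_succ,
    Finset.sum_congr rfl fun i hi => by
      rw [show splice n d c f i = d i by simp [splice, Finset.mem_range.1 hi]]]
  have : splice n d c f n = c := by simp [splice]
  rw [this, add_assoc, add_assoc, ← add_div, ← add_div, h]

lemma isUnivoque_of_unique {M : ℕ} {q : ℝ} (hq : 1 < q) (hqM : q ≤ M + 1) {d : Digits M}
    (hd : ∀ e : Digits M, piQ M q e = piQ M q d → e = d) : IsUnivoque M q d := by
  have hne : ∀ (n : ℕ) (c : Fin (M + 1)) (y : ℝ), 0 ≤ y → y ≤ M / (q - 1) →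
      (c : ℝ) + y = (d n : ℝ) + piQ M q (shift (n + 1) d) → c = d n := by
    intro n c y h0 h1 h2
    obtain ⟨f, rfl⟩ := exists_expansion hq hqM h0 h1
    rw [← hd _ (piQ_splice hq n d c f h2)]
    simp [splice]
  intro n
  have h0 := piQ_nonneg hq (shift (n + 1) d)
  have h1 := piQ_le hq (shift (n + 1) d)
  refine ⟨fun hn => ?_, fun hn => ?_⟩ <;> by_contra! hcon
  · have := hne n ⟨d n + 1, by omega⟩ (piQ M q (shift (n + 1) d) - 1) (by linarith)
      (by linarith) (by push_cast; ring)
    simpa using congrArg Fin.val this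
  · have := hne n ⟨d n - 1, by omega⟩ (piQ M q (shift (n + 1) d) + 1) (by linarith)
      (by linarith) (by push_cast [Nat.cast_sub (Nat.one_le_iff_ne_zero.2 hn.ne')]; ring)
    have := congrArg Fin.val this
    simp only at this
    omega

/-- Bases in which a block `M^k` following a digit below `M` can only be continued
periodically in a unique expansion, while that continuation is admissible. -/
structure IsForcing (M k : ℕ) (q : ℝ) : Prop where
  one_lt : 1 < q
  lt_one_add : (M : ℝ) / (q - 1) < 1 + (q ^ k)⁻¹
  lt_max : 1 + (M : ℝ) / (q - 1) * (q ^ k)⁻¹ * (1 - (q ^ k)⁻¹) < (M : ℝ) / (q - 1)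

lemma IsForcing.le {M k : ℕ} {q : ℝ} (h : IsForcing M k q) : q ≤ M + 1 := by
  have h1 := h.one_lt
  have h2 := h.lt_max
  have h3 : (q ^ k)⁻¹ ≤ 1 := inv_le_one_of_one_le₀ (one_le_pow₀ h1.le)
  have h4 : 0 < (q ^ k)⁻¹ := by positivity
  have h5 : 0 ≤ (M : ℝ) / (q - 1) := div_nonneg (by positivity) (by linarith)
  have h6 : 0 ≤ (M : ℝ) / (q - 1) * (q ^ k)⁻¹ * (1 - (q ^ k)⁻¹) :=
    mul_nonneg (by positivity) (by linarith)
  have h7 : 1 ≤ (M : ℝ) / (q - 1) := by linarith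
  rw [le_div_iff₀ (by linarith)] at h7
  linarith

/-- The sequence `(M^k 0^k)^∞`. -/
def alternating (M k : ℕ) : Digits M := fun j => if (j / k) % 2 = 0 then Fin.last M else 0

lemma alternating_of_lt {M k j : ℕ} (hj : j < k) : alternating M k j = Fin.last M := by
  simp [alternating, Nat.div_eq_of_lt hj]

lemma shift_alternating {M k : ℕ} (hk : 0 < k) :
    shift k (alternating M k) = conj (alternating M k) := by
  funext j
  simp only [shift_apply, alternating, conj, Nat.add_div_left _ hk]
  split_ifs with h1 h2 h2
  · omega
  · simp
  · simp
  · omega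

lemma piQ_alternating {M k : ℕ} {q : ℝ} (hq : 1 < q) (hk : 0 < k) :
    piQ M q (alternating M k) * (1 + (q ^ k)⁻¹) = M / (q - 1) := by
  have h := piQ_of_max_prefix hq (d := alternating M k) (n := k)
    fun i hi => by rw [alternating_of_lt hi, Fin.val_last]
  rw [shift_alternating hk, piQ_conj hq] at h
  linarith

lemma IsForcing.piQ_alternating_lt_one {M k : ℕ} {q : ℝ} (h : IsForcing M k q) (hk : 0 < k) :
    piQ M q (alternating M k) < 1 := by
  have h1 := piQ_alternating (M := M) h.one_lt hk
  have h2 := h.lt_one_add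
  have := h.one_lt
  have h3 : 0 < 1 + (q ^ k)⁻¹ := by positivity
  rw [← h1] at h2
  exact (mul_lt_iff_lt_one_left h3).1 h2

lemma IsForcing.isUnivoque_alternating {M k : ℕ} {q : ℝ} (h : IsForcing M k q) (hk : 0 < k) :
    IsUnivoque M q (alternating M k) := by
  have hq := h.one_lt
  intro j
  induction j using Nat.strong_induction_on with
  | _ j ih =>
  rcases lt_or_ge j k with hj | hj
  · rw [alternating_of_lt hj, Fin.val_last]
    refine ⟨fun hlt => absurd hlt (lt_irrefl _), fun _ => ?_⟩
    have h1 := piQ_of_max_prefix hq (d := shift (j + 1) (alternating M k)) (n := k - (j + 1))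
      fun i hi => by rw [shift_apply, alternating_of_lt (by omega), Fin.val_last]
    rw [shift_shift, show j + 1 + (k - (j + 1)) = k by omega, shift_alternating hk,
      piQ_conj hq] at h1
    have h2 := h.piQ_alternating_lt_one hk
    have h3 : (q ^ (k - (j + 1)))⁻¹ ≤ 1 := inv_le_one_of_one_le₀ (one_le_pow₀ hq.le)
    have h4 := piQ_nonneg hq (alternating M k)
    rw [h1]
    nlinarith
  · obtain ⟨i, rfl⟩ := Nat.exists_eq_add_of_le hj
    have hi := ih i (by omega)
    have e1 : shift (k + i + 1) (alternating M k) = conj (shift (i + 1) (alternating M k)) := by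
      rw [← shift_conj, ← shift_alternating hk, shift_shift, add_assoc]
    have e2 : (alternating M k (k + i) : ℕ) = M - (alternating M k i : ℕ) := by
      rw [← conj_val, ← shift_alternating hk, shift_apply]
    rw [e1, e2, piQ_conj hq]
    have := digit_le (alternating M k) i
    exact ⟨fun hlt => by linarith [hi.2 (by omega)], fun hlt => by linarith [hi.1 (by omega)]⟩

lemma IsForcing.next_block {M k : ℕ} {q : ℝ} (h : IsForcing M k q) (hM : 0 < M) (hk : 0 < k)
    {f : Digits M} (hf : IsUnivoque M q f) (hmax : ∀ i < k, f i = Fin.last M)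
    (hlt : piQ M q f < 1) :
    (∀ i < k, conj (shift k f) i = Fin.last M) ∧ piQ M q (conj (shift k f)) < 1 := by
  have hq := h.one_lt
  have h1 := piQ_of_max_prefix hq (d := f) (n := k) fun i hi => by rw [hmax i hi, Fin.val_last]
  refine ⟨fun i hi => ?_, ?_⟩
  · rw [← Fin.val_inj, conj_val, Fin.val_last, shift_apply]
    by_contra hne
    have hpos : 0 < (f (k + i) : ℕ) := by omega
    have h2 := (hf (k + i)).2 hpos
    have h3 : (1 : ℝ) ≤ f (k + i) := by exact_mod_cast hpos
    have h4 := piQ_eq_div hq (shift (k + i) f)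
    rw [shift_shift, shift_apply, add_zero] at h4
    have h5 := piQ_shift_div_le hq (shift k f) i
    rw [shift_shift] at h5
    have h6 : (M : ℝ) / (q - 1) * (q ^ k)⁻¹ ≤ piQ M q (shift k f) := by
      refine le_trans ?_ h5
      rw [h4, div_div, ← pow_succ', ← div_eq_mul_inv]
      have h7 : q ^ (i + 1) ≤ q ^ k := pow_le_pow_right₀ hq.le hi
      have h8 : 0 ≤ (M : ℝ) / (q - 1) := div_nonneg (by positivity) (by linarith)
      exact div_le_div₀ (by linarith) (by linarith) (by positivity) h7
    have h9 : 0 < (q ^ k)⁻¹ := by positivity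
    have := h.lt_max
    nlinarith
  · have h2 := (hf (k - 1)).2 (by rw [hmax _ (by omega), Fin.val_last]; exact hM)
    rw [show k - 1 + 1 = k by omega] at h2
    rw [piQ_conj hq]
    linarith

lemma IsForcing.eq_alternating {M k : ℕ} {q : ℝ} (h : IsForcing M k q) (hM : 0 < M) (hk : 0 < k)
    {f : Digits M} (hf : IsUnivoque M q f) (hmax : ∀ i < k, f i = Fin.last M)
    (hlt : piQ M q f < 1) : f = alternating M k := by
  have key : ∀ (j : ℕ) (f : Digits M), IsUnivoque M q f → (∀ i < k, f i = Fin.last M) →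
      piQ M q f < 1 → f j = alternating M k j := by
    intro j
    induction j using Nat.strong_induction_on with
    | _ j ih =>
    intro f hf hmax hlt
    rcases lt_or_ge j k with hj | hj
    · rw [hmax j hj, alternating_of_lt hj]
    · obtain ⟨i, rfl⟩ := Nat.exists_eq_add_of_le hj
      obtain ⟨h1, h2⟩ := h.next_block hM hk hf hmax hlt
      have h3 := ih i (by omega) _ ((hf.shift k).conj h.one_lt) h1 h2
      have h4 := congrFun (shift_alternating (M := M) hk) i
      rw [← shift_apply k i (alternating M k), h4, conj, ← h3]
      simp [conj]
  exact funext fun j => key j f hf hmax hlt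

lemma IsForcing.isUnivoque_splice {M m : ℕ} {q : ℝ} (h : IsForcing M (m + 1) q) (hM : 0 < M)
    (e : Digits M) : IsUnivoque M q (splice m e 0 (alternating M (m + 1))) := by
  have hq := h.one_lt
  have hm : splice m e 0 (alternating M (m + 1)) m = 0 := by simp [splice]
  have hlast : splice m e 0 (alternating M (m + 1)) (m + 1) = Fin.last M := by
    simp [splice, alternating]
  intro n
  rcases lt_trichotomy n m with hn | rfl | hn
  · have hmono : ∀ i ≤ m + 1, (q ^ (m + 1))⁻¹ ≤ (q ^ i)⁻¹ := fun i hi =>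
      inv_anti₀ (by positivity) (pow_le_pow_right₀ hq.le hi)
    have h1 := inv_pow_le_piQ hq (shift (n + 1) (splice m e 0 (alternating M (m + 1))))
      (n := m - n) (by
        rw [shift_apply, show n + 1 + (m - n) = m + 1 by omega, hlast, Fin.val_last]; exact hM)
    have h2 := piQ_le_of_lt hq (shift (n + 1) (splice m e 0 (alternating M (m + 1))))
      (n := m - (n + 1)) (by
        rw [shift_apply, show n + 1 + (m - (n + 1)) = m by omega, hm]; simpa using hM)
    have h3 := h.lt_one_add
    exact ⟨fun _ => by linarith [hmono (m - (n + 1) + 1) (by omega)],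
      fun _ => by linarith [hmono (m - n + 1) (by omega)]⟩
  · rw [shift_splice, hm]
    exact ⟨fun _ => h.piQ_alternating_lt_one (by omega), fun hlt => by simp at hlt⟩
  · obtain ⟨i, rfl⟩ := Nat.exists_eq_add_of_le (Nat.succ_le_of_lt hn)
    have h1 := h.isUnivoque_alternating (by omega) i
    rw [← shift_splice m e 0 (alternating M (m + 1)), shift_shift, shift_apply] at h1
    exact h1

lemma eventually_prefix_eq {M : ℕ} {q : ℝ} (hq : 1 < q) {d : Digits M} (hd : IsUnivoque M q d)
    (n : ℕ) : ∀ᶠ r in 𝓝 q, ∀ e : Digits M, piQ M r e = piQ M q d → ∀ i < n, e i = d i := by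
  have orbit : ∃ y : ℕ → ℝ → ℝ, (∀ n, Continuous (y n)) ∧ (∀ r, y 0 r = piQ M q d) ∧
      ∀ n r, y (n + 1) r = r * y n r - d n := by
    refine ⟨fun n => Nat.rec (fun _ => piQ M q d) (fun n y r => r * y r - d n) n, fun n => ?_,
      fun _ => rfl, fun _ _ => rfl⟩
    induction n with
    | zero => exact continuous_const
    | succ n ih => exact (continuous_id.mul ih).sub continuous_const
  obtain ⟨y, hyc, hy0, hys⟩ := orbit
  have hyq : ∀ n, y n q = piQ M q (shift n d) := by
    intro n
    induction n with
    | zero => rw [hy0, shift_zero]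
    | succ n ih => rw [hys, ih, piQ_shift_succ hq]
  have hbound : ContinuousAt (fun r : ℝ => (M : ℝ) / (r - 1) - 1) q :=
    ((continuousAt_const.div (continuousAt_id.sub continuousAt_const)
      (sub_ne_zero.2 hq.ne')).sub continuousAt_const)
  have main : ∀ᶠ r in 𝓝 q, ∀ e : Digits M, piQ M r e = piQ M q d →
      (∀ i < n, e i = d i) ∧ piQ M r (shift n e) = y n r := by
    induction n with
    | zero =>
      refine Eventually.of_forall fun r e he => ⟨fun i hi => by omega, ?_⟩
      rw [shift_zero, he, hy0]
    | succ n ih =>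
      have hlow : ∀ᶠ r in 𝓝 q, (d n : ℕ) < M → y (n + 1) r < 1 := by
        by_cases hdn : (d n : ℕ) < M
        · filter_upwards [(hyc (n + 1)).continuousAt.eventually_lt continuousAt_const
            (by rw [hyq]; exact (hd n).1 hdn)] with r hr _ using hr
        · exact Eventually.of_forall fun r hr => absurd hr hdn
      have hhigh : ∀ᶠ r in 𝓝 q, 0 < (d n : ℕ) → (M : ℝ) / (r - 1) - 1 < y (n + 1) r := by
        by_cases hdn : 0 < (d n : ℕ)
        · filter_upwards [hbound.eventually_lt (hyc (n + 1)).continuousAt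
            (by rw [hyq]; exact (hd n).2 hdn)] with r hr _ using hr
        · exact Eventually.of_forall fun r hr => absurd hr hdn
      filter_upwards [ih, hlow, hhigh, lt_mem_nhds hq] with r hr hl hh hr1 e he
      obtain ⟨hpre, hval⟩ := hr e he
      have hs := piQ_shift_succ hr1 e n
      have hsy := hys n r
      rw [hval] at hs
      have h0 := piQ_nonneg hr1 (shift (n + 1) e)
      have h1 := piQ_le hr1 (shift (n + 1) e)
      have hen : e n = d n := by
        rcases lt_trichotomy (e n) (d n) with hlt | heq | hgt
        · have hlt' : (e n : ℕ) < d n := hlt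
          have h3 := hh (by omega)
          have h5 : (e n : ℝ) + 1 ≤ d n := by exact_mod_cast hlt'
          linarith
        · exact heq
        · have hlt' : (d n : ℕ) < e n := hgt
          have h3 := hl (by have := digit_le e n; omega)
          have h5 : (d n : ℝ) + 1 ≤ e n := by exact_mod_cast hlt'
          linarith
      refine ⟨fun i hi => ?_, by rw [hs, hsy, hen]⟩
      rcases Nat.lt_succ_iff_lt_or_eq.1 hi with hi | rfl
      · exact hpre i hi
      · exact hen
  filter_upwards [main] with r hr e he using (hr e he).1

lemma piQ_strictAnti {M : ℕ} {d : Digits M} {n : ℕ} (hn : 0 < (d n : ℕ)) {q r : ℝ} (hq : 1 < q)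
    (hqr : q < r) : piQ M r d < piQ M q d := by
  refine Summable.tsum_lt_tsum (i := n) (fun i => ?_) ?_ (summable_digits (hq.trans hqr) d)
    (summable_digits hq d)
  · dsimp only
    gcongr
  · have : (0 : ℝ) < d n := by exact_mod_cast hn
    gcongr

lemma continuousOn_piQ {M : ℕ} (d : Digits M) : ContinuousOn (fun q => piQ M q d) (Set.Ioi 1) := by
  intro q hq
  have hq : 1 < q := hq
  obtain ⟨s, hs1, hsq⟩ := exists_between hq
  have hc : ContinuousOn (fun q => piQ M q d) (Set.Ici s) := by
    refine continuousOn_tsum (fun i => ?_) (hasSum_const_digits M hs1).summable fun i r hr => ?_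
    · refine continuousOn_const.div (continuousOn_id.pow _) fun r hr => ?_
      have : s ≤ r := hr
      have : 0 < r := by linarith
      exact pow_ne_zero _ this.ne'
    · have hr : s ≤ r := hr
      have h1 := digit_cast_le d i
      have : 0 < r := by linarith
      rw [Real.norm_of_nonneg (by positivity)]
      gcongr
  exact (hc.continuousAt (Ici_mem_nhds hsq)).continuousWithinAt

lemma IsForcing.eventually {M k : ℕ} {q : ℝ} (h : IsForcing M k q) :
    ∀ᶠ r in 𝓝 q, IsForcing M k r := by
  have hq := h.one_lt
  have hA : ContinuousAt (fun r : ℝ => (M : ℝ) / (r - 1)) q :=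
    continuousAt_const.div (continuousAt_id.sub continuousAt_const) (sub_ne_zero.2 hq.ne')
  have ht : ContinuousAt (fun r : ℝ => (r ^ k)⁻¹) q :=
    (continuousAt_id.pow k).inv₀ (pow_ne_zero k (zero_lt_one.trans hq).ne')
  filter_upwards [lt_mem_nhds hq, hA.eventually_lt (continuousAt_const.add ht) h.lt_one_add,
    (continuousAt_const.add ((hA.mul ht).mul (continuousAt_const.sub ht))).eventually_lt hA
      h.lt_max] with r h1 h2 h3 using ⟨h1, h2, h3⟩

lemma IsForcing.piQ_splice_mem_Xiso {M m : ℕ} {q : ℝ} (h : IsForcing M (m + 1) q) (hM : 0 < M)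
    (e : Digits M) : piQ M q (splice m e 0 (alternating M (m + 1))) ∈ Xiso M := by
  have hq := h.one_lt
  set d := splice m e 0 (alternating M (m + 1)) with hd
  have hu : IsUnivoque M q d := h.isUnivoque_splice hM e
  have hmax : ∀ i < m + 1, d (m + 1 + i) = Fin.last M := fun i hi => by
    rw [← shift_apply (m + 1) i d, hd, shift_splice, alternating_of_lt hi]
  have hpos : 0 < (d (m + 1) : ℕ) := by
    rw [show d (m + 1) = Fin.last M from hmax 0 (by omega), Fin.val_last]
    exact hM
  refine ⟨lt_of_lt_of_le (by positivity) (inv_pow_le_piQ hq d hpos), q,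
    ⟨⟨hq, h.le⟩, hu.mem_Uq hq⟩, ?_⟩
  have hiso : ∀ᶠ r in 𝓝 q, r ∈ Ubases M (piQ M q d) → r = q := by
    filter_upwards [h.eventually, eventually_prefix_eq hq hu (m + 1 + (m + 1))] with r hr hpre hrU
    obtain ⟨⟨hr1, hrM⟩, f, hf, hfu⟩ := hrU
    simp only at hf hfu
    have hfuniv : IsUnivoque M r f :=
      isUnivoque_of_unique hr1 hrM fun g hg => hfu g (hg.trans hf)
    have hfd := hpre f hf
    have htail : shift (m + 1) f = alternating M (m + 1) := by
      refine hr.eq_alternating hM (by omega) (hfuniv.shift _) (fun i hi => ?_) ?_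
      · rw [shift_apply, hfd _ (by omega), hmax i hi]
      · refine (hfuniv m).1 ?_
        rw [hfd m (by omega), hd]
        simpa [splice] using hM
    have hfeq : f = d := by
      funext i
      rcases lt_or_ge i (m + 1) with hi | hi
      · exact hfd i (by omega)
      · obtain ⟨j, rfl⟩ := Nat.exists_eq_add_of_le hi
        rw [← shift_apply (m + 1) j f, htail, ← shift_apply (m + 1) j d, hd, shift_splice]
    rw [hfeq] at hf
    rcases lt_trichotomy r q with hlt | heq | hgt
    · exact absurd hf (piQ_strictAnti hpos hr1 hlt).ne'
    · exact heq
    · exact absurd hf (piQ_strictAnti hpos hq hgt).ne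
  obtain ⟨ε, hε, hball⟩ := Metric.eventually_nhds_iff.1 hiso
  refine ⟨ε, hε, Set.eq_singleton_iff_unique_mem.2 ⟨⟨⟨⟨hq, h.le⟩, hu.mem_Uq hq⟩, ?_⟩, ?_⟩⟩
  · constructor <;> linarith
  · rintro r ⟨hrU, hr1, hr2⟩
    refine hball ?_ hrU
    rw [Real.dist_eq, abs_lt]
    constructor <;> linarith

lemma exists_isForcing {M : ℕ} (hM : 0 < M) {k : ℕ} (hk : 0 < k) :
    ∃ q : ℝ, 3 / 2 ≤ q ∧ IsForcing M k q := by
  have hM1 : (1 : ℝ) ≤ M := by exact_mod_cast hM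
  let g : ℝ → ℝ := fun q => (q - 1) * (1 + (q ^ k)⁻¹ - ((q ^ k)⁻¹) ^ 3 / 2)
  have ht : ∀ q : ℝ, 3 / 2 ≤ q → 0 < (q ^ k)⁻¹ ∧ (q ^ k)⁻¹ < 1 := fun q hq =>
    ⟨inv_pos.2 (pow_pos (by linarith) _),
      inv_lt_one_of_one_lt₀ (one_lt_pow₀ (by linarith) hk.ne')⟩
  have hg : ContinuousOn g (Set.Icc (3 / 2) (M + 1)) := by
    have hinv : ContinuousOn (fun q : ℝ => (q ^ k)⁻¹) (Set.Icc (3 / 2) (M + 1)) :=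
      (continuousOn_id.pow k).inv₀ fun q hq => pow_ne_zero _ (by
        have : (3 / 2 : ℝ) ≤ q := hq.1
        simp only [id]
        linarith)
    exact (continuousOn_id.sub continuousOn_const).mul
      ((continuousOn_const.add hinv).sub ((hinv.pow 3).div_const 2))
  have hleft : g (3 / 2) ≤ M := by
    obtain ⟨h0, h1⟩ := ht (3 / 2) le_rfl
    have : 0 < (((3 / 2 : ℝ) ^ k)⁻¹) ^ 3 := by positivity
    simp only [g]
    linarith
  have hright : (M : ℝ) ≤ g (M + 1) := by
    obtain ⟨h0, h1⟩ := ht (M + 1) (by linarith)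
    simp only [g]
    have : (((M + 1 : ℝ) ^ k)⁻¹) ^ 3 ≤ ((M + 1 : ℝ) ^ k)⁻¹ :=
      pow_le_of_le_one h0.le h1.le (by norm_num)
    nlinarith
  obtain ⟨q, ⟨hq, -⟩, hgq⟩ := intermediate_value_Icc (by linarith) hg ⟨hleft, hright⟩
  obtain ⟨h0, h1⟩ := ht q hq
  have hA : (M : ℝ) / (q - 1) = 1 + (q ^ k)⁻¹ - ((q ^ k)⁻¹) ^ 3 / 2 := by
    rw [← hgq]
    simp only [g]
    rw [mul_div_cancel_left₀]
    linarith
  refine ⟨q, hq, by linarith, ?_, ?_⟩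
  · rw [hA]
    have : 0 < ((q ^ k)⁻¹) ^ 3 := by positivity
    linarith
  · rw [hA]
    generalize (q ^ k)⁻¹ = t at h0 h1
    have h3 : 0 < t ^ 3 := by positivity
    have h4 : 0 < t ^ 4 * (1 - t) := mul_pos (by positivity) (by linarith)
    nlinarith

/-- For every `x ∈ [0,1]` and every `δ > 0`, the intersection `X_iso ∩ (x-δ, x+δ)`
contains a nonempty open interval. -/
theorem Xiso_contains_interval (M : ℕ) (hM : 0 < M) (x : ℝ) (hx : x ∈ Set.Icc (0 : ℝ) 1)
    (δ : ℝ) (hδ : 0 < δ) :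
    ∃ a b : ℝ, a < b ∧ Set.Ioo a b ⊆ Xiso M ∩ Set.Ioo (x - δ) (x + δ) := by
  obtain ⟨m, hm⟩ := exists_pow_lt_of_lt_one (show 0 < δ / 2 by linarith)
    (show (2 / 3 : ℝ) < 1 by norm_num)
  obtain ⟨q, hq32, hq⟩ := exists_isForcing hM (show 0 < m + 1 by omega)
  have hq1 := hq.one_lt
  have hA1 : 1 ≤ (M : ℝ) / (q - 1) := by
    rw [le_div_iff₀ (by linarith)]
    linarith [hq.le]
  have hA2 : (M : ℝ) / (q - 1) ≤ 2 := by
    have : (q ^ (m + 1))⁻¹ ≤ 1 := inv_le_one_of_one_le₀ (one_le_pow₀ hq1.le)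
    linarith [hq.lt_one_add]
  obtain ⟨e, he⟩ := exists_expansion hq1 hq.le hx.1 (hx.2.trans hA1)
  set d := splice m e 0 (alternating M (m + 1)) with hd
  have hclose : |piQ M q d - x| < δ := by
    rw [← he]
    refine (abs_piQ_sub_le hq1 (n := m) fun i hi => by simp [hd, splice, hi]).trans_lt ?_
    have h1 : (q ^ m)⁻¹ ≤ (2 / 3) ^ m := by
      rw [← inv_pow]
      have : q⁻¹ ≤ 2 / 3 := by
        rw [inv_le_comm₀ (by linarith) (by norm_num)]
        linarith
      exact pow_le_pow_left₀ (inv_nonneg.2 (by linarith)) this m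
    have h2 : 0 < (q ^ m)⁻¹ := by positivity
    rw [div_eq_mul_inv]
    nlinarith
  have hnear : ∀ᶠ r in 𝓝 q, IsForcing M (m + 1) r ∧ |piQ M r d - x| < δ :=
    hq.eventually.and ((((continuousOn_piQ d).continuousAt (Ioi_mem_nhds hq1)).sub
      continuousAt_const).abs.eventually_lt continuousAt_const hclose)
  obtain ⟨ε, hε, hball⟩ := Metric.eventually_nhds_iff.1 hnear
  have hpos : 0 < (d (m + 1) : ℕ) := by simpa [hd, splice, alternating] using hM
  refine ⟨piQ M (q + ε / 2) d, piQ M q d, piQ_strictAnti hpos hq1 (by linarith), ?_⟩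
  refine (intermediate_value_Ioo' (by linarith : q ≤ q + ε / 2)
    ((continuousOn_piQ d).mono fun r hr => hq1.trans_le hr.1)).trans ?_
  rintro _ ⟨r, ⟨hr1, hr2⟩, rfl⟩
  obtain ⟨hr, hrx⟩ := hball (show dist r q < ε by
    rw [Real.dist_eq, abs_lt]
    constructor <;> linarith)
  rw [abs_lt] at hrx
  exact ⟨hr.piQ_splice_mem_Xiso hM e, by linarith, by linarith⟩

end Expansions
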